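/- Let N and M be quantum channels from system A to system B such that (1/2)‖N − M‖_⋄ ≤ ε for some ε ∈ [0,1]. Then |S(N) − S(M)| ≤ 2ε·log|B| + (ε+1)·log(ε+1) − ε·log ε. -/

import Mathlib

open scoped Kronecker ComplexOrder

noncomputable section

namespace QIT

variable {n : Type*} [Fintype n] [DecidableEq n]

/-- Real trace of a complex matrix. -/
def rtr (A : Matrix n n ℂ) : ℝ := (Matrix.trace A).re

/-- Apply a real function to a hermitian matrix via spectral decomposition
(junk value `0` for non-hermitian input). -/
def mfun (f : ℝ → ℝ) (A : Matrix n n ℂ) : Matrix n n ℂ :=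
  if hA : A.IsHermitian then
    (Matrix.IsHermitian.eigenvectorUnitary hA : Matrix n n ℂ) *
      Matrix.diagonal (fun i => ((f (hA.eigenvalues i) : ℝ) : ℂ)) *
      (star (Matrix.IsHermitian.eigenvectorUnitary hA : Matrix n n ℂ))
  else 0

/-- Real power of a positive semidefinite matrix (with the conventions
`0 ^ p = 0` for `p ≠ 0`, i.e. powers are taken on the support). -/
def mpow (A : Matrix n n ℂ) (p : ℝ) : Matrix n n ℂ := mfun (fun x => x ^ p) A

/-- Matrix base-2 logarithm (on the support). -/
def mlog (A : Matrix n n ℂ) : Matrix n n ℂ := mfun (Real.logb 2) A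

/-- A quantum state: positive semidefinite with unit trace. -/
def IsState (ρ : Matrix n n ℂ) : Prop := ρ.PosSemidef ∧ Matrix.trace ρ = 1

/-- A pure state: a state of rank one. -/
def IsPureState (ρ : Matrix n n ℂ) : Prop := IsState ρ ∧ ρ.rank = 1

/-- The support (range) ordering: `supp ρ ⊆ supp σ`, expressed as
`ker σ ≤ ker ρ`. -/
def SuppLE (ρ σ : Matrix n n ℂ) : Prop := ∀ v : n → ℂ, σ.mulVec v = 0 → ρ.mulVec v = 0

/-- Trace norm ‖X‖₁ = Tr √(X† X). -/
def traceNorm (X : Matrix n n ℂ) : ℝ := rtr (mpow (X.conjTranspose * X) (2⁻¹ : ℝ))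

/-- von Neumann entropy (base 2). -/
def vnEnt (ρ : Matrix n n ℂ) : ℝ := - rtr (ρ * mlog ρ)

/-- Umegaki relative entropy (base 2), real-valued on its finiteness domain. -/
def relEnt (ρ σ : Matrix n n ℂ) : ℝ := rtr (ρ * mlog ρ) - rtr (ρ * mlog σ)

/-- The sandwiched trace functional Tr{(σ^((1-α)/(2α)) ρ σ^((1-α)/(2α)))^α}. -/
def sandTr (α : ℝ) (ρ σ : Matrix n n ℂ) : ℝ :=
  rtr (mpow (mpow σ ((1 - α) / (2 * α)) * ρ * mpow σ ((1 - α) / (2 * α))) α)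

/-- Sandwiched Rényi relative entropy (base 2). -/
def sandRenyi (α : ℝ) (ρ σ : Matrix n n ℂ) : ℝ := (α - 1)⁻¹ * Real.logb 2 (sandTr α ρ σ)

/-- Sandwiched Tsallis relative entropy. -/
def sandTsallis (α : ℝ) (ρ σ : Matrix n n ℂ) : ℝ := (α - 1)⁻¹ * (sandTr α ρ σ - 1)

/-- (Non-sandwiched) Tsallis relative entropy. -/
def tsallisRel (α : ℝ) (ρ σ : Matrix n n ℂ) : ℝ :=
  (α - 1)⁻¹ * (rtr (mpow ρ α * mpow σ (1 - α)) - 1)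

/-- Tsallis entropy of a state. -/
def tsallisEnt (α : ℝ) (ρ : Matrix n n ℂ) : ℝ := (1 - α)⁻¹ * (rtr (mpow ρ α) - 1)

variable {a b c r : Type*} [Fintype a] [DecidableEq a] [Fintype b] [DecidableEq b]
  [Fintype c] [DecidableEq c] [Fintype r] [DecidableEq r]

/-- Partial trace over the first tensor factor. -/
def ptraceA (ρ : Matrix (a × b) (a × b) ℂ) : Matrix b b ℂ :=
  Matrix.of fun i j => ∑ k : a, ρ (k, i) (k, j)

/-- Partial trace over the second tensor factor. -/
def ptraceB (ρ : Matrix (a × b) (a × b) ℂ) : Matrix a a ℂ :=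
  Matrix.of fun i j => ∑ k : b, ρ (i, k) (j, k)

/-- Conditional sandwiched Rényi entropy H̃↓_α(A|B). -/
def condRenyiDown (α : ℝ) (ρ : Matrix (a × b) (a × b) ℂ) : ℝ :=
  - sandRenyi α ρ ((1 : Matrix a a ℂ) ⊗ₖ ptraceA ρ)

/-- Conditional sandwiched Tsallis entropy T̃↓_α(A|B). -/
def condTsallisSandDown (α : ℝ) (ρ : Matrix (a × b) (a × b) ℂ) : ℝ :=
  - sandTsallis α ρ ((1 : Matrix a a ℂ) ⊗ₖ ptraceA ρ)

/-- Optimized conditional sandwiched Tsallis entropy T̃↑_α(A|B). -/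
def condTsallisSandUp (α : ℝ) (ρ : Matrix (a × b) (a × b) ℂ) : ℝ :=
  - ⨅ σ : {σ : Matrix b b ℂ // IsState σ}, sandTsallis α ρ ((1 : Matrix a a ℂ) ⊗ₖ σ.1)

/-- Conditional (non-sandwiched) Tsallis entropy T↓_α(A|B). -/
def condTsallisDown (α : ℝ) (ρ : Matrix (a × b) (a × b) ℂ) : ℝ :=
  - tsallisRel α ρ ((1 : Matrix a a ℂ) ⊗ₖ ptraceA ρ)

/-- Conditional von Neumann entropy H(A|B) = S(AB) - S(B). -/
def condvnEnt (ρ : Matrix (a × b) (a × b) ℂ) : ℝ := vnEnt ρ - vnEnt (ptraceA ρ)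

/-- The extension `N ⊗ I_r` of a linear map on matrices. -/
def tensorId (N : Matrix a a ℂ →ₗ[ℂ] Matrix b b ℂ) (r : Type*) [Fintype r] [DecidableEq r] :
    Matrix (a × r) (a × r) ℂ →ₗ[ℂ] Matrix (b × r) (b × r) ℂ where
  toFun ρ := Matrix.of fun p q => N (Matrix.of fun x y => ρ (x, p.2) (y, q.2)) p.1 q.1
  map_add' ρ₁ ρ₂ := by
    ext p q
    have h : (Matrix.of fun x y => (ρ₁ + ρ₂) (x, p.2) (y, q.2))
        = (Matrix.of fun x y => ρ₁ (x, p.2) (y, q.2))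
          + (Matrix.of fun x y => ρ₂ (x, p.2) (y, q.2)) := by
      ext x y; simp
    show N (Matrix.of fun x y => (ρ₁ + ρ₂) (x, p.2) (y, q.2)) p.1 q.1 = _
    rw [h, map_add]; rfl
  map_smul' z ρ := by
    ext p q
    have h : (Matrix.of fun x y => (z • ρ) (x, p.2) (y, q.2))
        = z • (Matrix.of fun x y => ρ (x, p.2) (y, q.2)) := by
      ext x y; simp
    show N (Matrix.of fun x y => (z • ρ) (x, p.2) (y, q.2)) p.1 q.1 = _
    rw [h, map_smul]; rfl

/-- The extension `I_r ⊗ M` of a linear map on matrices. -/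
def idTensor (M : Matrix a a ℂ →ₗ[ℂ] Matrix b b ℂ) (r : Type*) [Fintype r] [DecidableEq r] :
    Matrix (r × a) (r × a) ℂ →ₗ[ℂ] Matrix (r × b) (r × b) ℂ where
  toFun ρ := Matrix.of fun p q => M (Matrix.of fun x y => ρ (p.1, x) (q.1, y)) p.2 q.2
  map_add' ρ₁ ρ₂ := by
    ext p q
    have h : (Matrix.of fun x y => (ρ₁ + ρ₂) (p.1, x) (q.1, y))
        = (Matrix.of fun x y => ρ₁ (p.1, x) (q.1, y))
          + (Matrix.of fun x y => ρ₂ (p.1, x) (q.1, y)) := by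
      ext x y; simp
    show M (Matrix.of fun x y => (ρ₁ + ρ₂) (p.1, x) (q.1, y)) p.2 q.2 = _
    rw [h, map_add]; rfl
  map_smul' z ρ := by
    ext p q
    have h : (Matrix.of fun x y => (z • ρ) (p.1, x) (q.1, y))
        = z • (Matrix.of fun x y => ρ (p.1, x) (q.1, y)) := by
      ext x y; simp
    show M (Matrix.of fun x y => (z • ρ) (p.1, x) (q.1, y)) p.2 q.2 = _
    rw [h, map_smul]; rfl

/-- A quantum channel: trace preserving and completely positive. -/
def IsChannel (N : Matrix a a ℂ →ₗ[ℂ] Matrix b b ℂ) : Prop :=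
  (∀ ρ : Matrix a a ℂ, Matrix.trace (N ρ) = Matrix.trace ρ) ∧
  ∀ (k : ℕ) (ρ : Matrix (a × Fin k) (a × Fin k) ℂ), ρ.PosSemidef →
    (tensorId N (Fin k) ρ).PosSemidef

/-- The maximally mixed state on system `b`. -/
def maxMixed (b : Type*) [Fintype b] [DecidableEq b] : Matrix b b ℂ :=
  ((Fintype.card b : ℂ))⁻¹ • (1 : Matrix b b ℂ)

/-- The completely randomizing (depolarizing) channel. -/
def randomizing (a b : Type*) [Fintype a] [DecidableEq a] [Fintype b] [DecidableEq b] :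
    Matrix a a ℂ →ₗ[ℂ] Matrix b b ℂ :=
  (Matrix.traceLinearMap a ℂ ℂ).smulRight (maxMixed b)

/-- The replacer channel `ρ ↦ Tr(ρ) σ`. -/
def replacer (a : Type*) [Fintype a] [DecidableEq a] (σ : Matrix b b ℂ) :
    Matrix a a ℂ →ₗ[ℂ] Matrix b b ℂ :=
  (Matrix.traceLinearMap a ℂ ℂ).smulRight σ

/-- Channel (Umegaki) relative entropy: supremum over all finite reference systems. -/
def chRelEnt (N M : Matrix a a ℂ →ₗ[ℂ] Matrix b b ℂ) : ℝ :=
  ⨆ p : Σ k : ℕ, {ρ : Matrix (a × Fin k) (a × Fin k) ℂ // IsState ρ},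
    relEnt (tensorId N (Fin p.1) p.2.1) (tensorId M (Fin p.1) p.2.1)

/-- Channel sandwiched Rényi relative entropy. -/
def chSandRenyi (α : ℝ) (N M : Matrix a a ℂ →ₗ[ℂ] Matrix b b ℂ) : ℝ :=
  ⨆ p : Σ k : ℕ, {ρ : Matrix (a × Fin k) (a × Fin k) ℂ // IsState ρ},
    sandRenyi α (tensorId N (Fin p.1) p.2.1) (tensorId M (Fin p.1) p.2.1)

/-- Channel sandwiched Tsallis relative entropy. -/
def chSandTsallis (α : ℝ) (N M : Matrix a a ℂ →ₗ[ℂ] Matrix b b ℂ) : ℝ :=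
  ⨆ p : Σ k : ℕ, {ρ : Matrix (a × Fin k) (a × Fin k) ℂ // IsState ρ},
    sandTsallis α (tensorId N (Fin p.1) p.2.1) (tensorId M (Fin p.1) p.2.1)

/-- Diamond distance between two maps. -/
def diamondDist (N M : Matrix a a ℂ →ₗ[ℂ] Matrix b b ℂ) : ℝ :=
  ⨆ p : Σ k : ℕ, {ρ : Matrix (a × Fin k) (a × Fin k) ℂ // IsState ρ},
    traceNorm (tensorId N (Fin p.1) p.2.1 - tensorId M (Fin p.1) p.2.1)

/-- Entropy of a quantum channel. -/
def chEnt (N : Matrix a a ℂ →ₗ[ℂ] Matrix b b ℂ) : ℝ :=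
  Real.logb 2 (Fintype.card b) - chRelEnt N (randomizing a b)

/-- α-Rényi entropy of a quantum channel. -/
def chRenyiEnt (α : ℝ) (N : Matrix a a ℂ →ₗ[ℂ] Matrix b b ℂ) : ℝ :=
  Real.logb 2 (Fintype.card b) - chSandRenyi α N (randomizing a b)

/-- α-Tsallis entropy of a quantum channel. -/
def chTsallisEnt (α : ℝ) (N : Matrix a a ℂ →ₗ[ℂ] Matrix b b ℂ) : ℝ :=
  ((Fintype.card b : ℝ) ^ (1 - α) - 1) / (1 - α)
    - (Fintype.card b : ℝ) ^ (1 - α) * chSandTsallis α N (randomizing a b)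


section Diagonalization

variable {n : Type*} [Fintype n] [DecidableEq n]

/-- `A = U diag(d) U†` with `U` unitary. -/
def Diagonalizes (U : Matrix n n ℂ) (d : n → ℝ) (A : Matrix n n ℂ) : Prop :=
  U ∈ Matrix.unitaryGroup n ℂ ∧ A = U * Matrix.diagonal (fun i => (d i : ℂ)) * star U

/-- Squared moduli of the inner products of the columns of `U` and `V`. -/
def overlap (U V : Matrix n n ℂ) (i j : n) : ℝ := Complex.normSq ((star U * V) i j)

omit [DecidableEq n] in
lemma overlap_nonneg (U V : Matrix n n ℂ) (i j : n) : 0 ≤ overlap U V i j :=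
  Complex.normSq_nonneg _

lemma sum_normSq_row {W : Matrix n n ℂ} (hW : W ∈ Matrix.unitaryGroup n ℂ) (i : n) :
    ∑ j, Complex.normSq (W i j) = 1 := by
  have h := congrFun (congrFun (Matrix.mem_unitaryGroup_iff.1 hW) i) i
  rw [Matrix.mul_apply, Matrix.one_apply_eq] at h
  have h2 : ∀ j, W i j * (star W) j i = ((Complex.normSq (W i j) : ℝ) : ℂ) := fun j => by
    rw [Matrix.star_apply, ← Complex.mul_conj]; rfl
  simp_rw [h2] at h
  exact_mod_cast h

lemma sum_normSq_col {W : Matrix n n ℂ} (hW : W ∈ Matrix.unitaryGroup n ℂ) (j : n) :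
    ∑ i, Complex.normSq (W i j) = 1 := by
  have := sum_normSq_row (Unitary.star_mem hW) j
  simpa [Matrix.star_apply] using this

lemma star_mul_mem {U V : Matrix n n ℂ} (hU : U ∈ Matrix.unitaryGroup n ℂ)
    (hV : V ∈ Matrix.unitaryGroup n ℂ) : star U * V ∈ Matrix.unitaryGroup n ℂ :=
  mul_mem (Unitary.star_mem hU) hV

lemma sum_overlap_right {U V : Matrix n n ℂ} (hU : U ∈ Matrix.unitaryGroup n ℂ)
    (hV : V ∈ Matrix.unitaryGroup n ℂ) (i : n) : ∑ j, overlap U V i j = 1 :=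
  sum_normSq_row (star_mul_mem hU hV) i

lemma sum_overlap_left {U V : Matrix n n ℂ} (hU : U ∈ Matrix.unitaryGroup n ℂ)
    (hV : V ∈ Matrix.unitaryGroup n ℂ) (j : n) : ∑ i, overlap U V i j = 1 :=
  sum_normSq_col (star_mul_mem hU hV) j

lemma exists_diagonalizes {A : Matrix n n ℂ} (hA : A.IsHermitian) :
    ∃ U d, Diagonalizes U d A := by
  refine ⟨hA.eigenvectorUnitary, hA.eigenvalues, hA.eigenvectorUnitary.2, ?_⟩
  conv_lhs => rw [hA.spectral_theorem]
  rfl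

lemma Diagonalizes.isHermitian {U A : Matrix n n ℂ} {d : n → ℝ} (h : Diagonalizes U d A) :
    A.IsHermitian := by
  rw [h.2, Matrix.IsHermitian, ← Matrix.star_eq_conjTranspose]
  simp only [star_mul, star_star, mul_assoc]
  congr 2
  rw [Matrix.star_eq_conjTranspose, Matrix.diagonal_conjTranspose]
  congr 1
  ext i
  simp

lemma Diagonalizes.star_mul {U A : Matrix n n ℂ} {d : n → ℝ} (h : Diagonalizes U d A) :
    star U * A = Matrix.diagonal (fun i => (d i : ℂ)) * star U := by
  rw [h.2, ← mul_assoc, ← mul_assoc, Matrix.mem_unitaryGroup_iff'.1 h.1, one_mul]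

lemma Diagonalizes.mul {U A : Matrix n n ℂ} {d : n → ℝ} (h : Diagonalizes U d A) :
    A * U = U * Matrix.diagonal (fun i => (d i : ℂ)) := by
  rw [h.2, mul_assoc, Matrix.mem_unitaryGroup_iff'.1 h.1, mul_one]

lemma Diagonalizes.star_mul_mul {U A : Matrix n n ℂ} {d : n → ℝ} (h : Diagonalizes U d A) :
    star U * A * U = Matrix.diagonal (fun i => (d i : ℂ)) := by
  rw [h.star_mul, mul_assoc, Matrix.mem_unitaryGroup_iff'.1 h.1, mul_one]

lemma Diagonalizes.apply_eq {U A : Matrix n n ℂ} {d : n → ℝ} (h : Diagonalizes U d A) (i : n) :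
    (d i : ℂ) = star (U.col i) ⬝ᵥ A.mulVec (U.col i) := by
  have := congrFun (congrFun h.star_mul_mul i) i
  rw [Matrix.diagonal_apply_eq] at this
  rw [← this, mul_assoc, Matrix.mul_apply]
  rfl

lemma Diagonalizes.nonneg {U A : Matrix n n ℂ} {d : n → ℝ} (h : Diagonalizes U d A)
    (hA : A.PosSemidef) (i : n) : 0 ≤ d i := by
  have := hA.dotProduct_mulVec_nonneg (U.col i)
  rw [← h.apply_eq] at this
  exact_mod_cast this

lemma Diagonalizes.posSemidef {U A : Matrix n n ℂ} {d : n → ℝ} (h : Diagonalizes U d A)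
    (hd : ∀ i, 0 ≤ d i) : A.PosSemidef := by
  rw [h.2]
  exact (Matrix.PosSemidef.diagonal (fun i => by
    show (0 : ℂ) ≤ (d i : ℂ)
    exact_mod_cast hd i)).mul_mul_conjTranspose_same U

lemma Diagonalizes.mfun_eq {U A : Matrix n n ℂ} {d : n → ℝ} (h : Diagonalizes U d A)
    (f : ℝ → ℝ) : mfun f A = U * Matrix.diagonal (fun i => ((f (d i) : ℝ) : ℂ)) * star U := by
  have hA := h.isHermitian
  obtain ⟨V, hV⟩ : ∃ V : Matrix n n ℂ, V = hA.eigenvectorUnitary := ⟨_, rfl⟩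
  obtain ⟨e, he⟩ : ∃ e, e = hA.eigenvalues := ⟨_, rfl⟩
  have hD : Diagonalizes V e A := by
    refine ⟨hV ▸ hA.eigenvectorUnitary.2, ?_⟩
    conv_lhs => rw [hA.spectral_theorem]
    rw [hV, he]
    rfl
  rw [mfun, dif_pos hA, ← hV, ← he]
  have hUU := Matrix.mem_unitaryGroup_iff.1 h.1
  have hVV := Matrix.mem_unitaryGroup_iff.1 hD.1
  have hW : Matrix.diagonal (fun i => (d i : ℂ)) * (star U * V)
      = (star U * V) * Matrix.diagonal (fun i => (e i : ℂ)) := by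
    rw [← mul_assoc, ← h.star_mul, mul_assoc, hD.mul, mul_assoc]
  have hW' : Matrix.diagonal (fun i => ((f (d i) : ℝ) : ℂ)) * (star U * V)
      = (star U * V) * Matrix.diagonal (fun i => ((f (e i) : ℝ) : ℂ)) := by
    ext i j
    have := congrFun (congrFun hW i) j
    rw [Matrix.diagonal_mul, Matrix.mul_diagonal] at this ⊢
    by_cases hz : (star U * V) i j = 0
    · simp [hz]
    · rw [mul_comm] at this
      have := mul_left_cancel₀ hz this
      have : d i = e j := by exact_mod_cast this
      rw [this, mul_comm]
  calc V * Matrix.diagonal (fun i => ((f (e i) : ℝ) : ℂ)) * star V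
      = U * ((star U * V) * Matrix.diagonal (fun i => ((f (e i) : ℝ) : ℂ))) * star V := by
        rw [← mul_assoc, ← mul_assoc, hUU, one_mul]
    _ = U * Matrix.diagonal (fun i => ((f (d i) : ℝ) : ℂ)) * star U * (V * star V) := by
        rw [← hW']; simp only [mul_assoc]
    _ = _ := by rw [hVV, mul_one]

lemma Diagonalizes.mfun {U A : Matrix n n ℂ} {d : n → ℝ} (h : Diagonalizes U d A)
    (f : ℝ → ℝ) : Diagonalizes U (fun i => f (d i)) (mfun f A) := ⟨h.1, h.mfun_eq f⟩

lemma Diagonalizes.rtr_mul {U V A B : Matrix n n ℂ} {a b : n → ℝ} (hA : Diagonalizes U a A)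
    (hB : Diagonalizes V b B) :
    rtr (A * B) = ∑ i, ∑ j, overlap U V i j * (a i * b j) := by
  obtain ⟨W, hW⟩ : ∃ W, W = star U * V := ⟨_, rfl⟩
  have h1 : (A * B).trace = (Matrix.diagonal (fun i => (a i : ℂ)) * (W *
      Matrix.diagonal (fun i => (b i : ℂ)) * star W)).trace := by
    rw [hA.2, hB.2, mul_assoc, mul_assoc, Matrix.trace_mul_comm U, hW]
    simp only [StarMul.star_mul, star_star, mul_assoc]
  have h2 : (A * B).trace = ((∑ i, ∑ j, overlap U V i j * (a i * b j) : ℝ) : ℂ) := by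
    rw [h1, Matrix.trace]
    push_cast
    refine Finset.sum_congr rfl fun i _ => ?_
    rw [Matrix.diag_apply, Matrix.diagonal_mul, Matrix.mul_apply, Finset.mul_sum]
    refine Finset.sum_congr rfl fun j _ => ?_
    rw [Matrix.mul_diagonal, Matrix.star_apply, overlap, ← hW, ← Complex.mul_conj]
    simp only [RCLike.star_def]
    ring
  rw [rtr, h2, Complex.ofReal_re]

lemma Diagonalizes.rtr_eq {U A : Matrix n n ℂ} {d : n → ℝ} (h : Diagonalizes U d A) :
    rtr A = ∑ i, d i := by
  rw [rtr, h.2, Matrix.trace_mul_comm, ← mul_assoc, Matrix.mem_unitaryGroup_iff'.1 h.1, one_mul,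
    Matrix.trace_diagonal]
  simp

lemma Diagonalizes.rtr_mul_mfun_self {U A : Matrix n n ℂ} {d : n → ℝ} (h : Diagonalizes U d A)
    (f : ℝ → ℝ) : rtr (A * QIT.mfun f A) = ∑ i, d i * f (d i) := by
  have : Diagonalizes U (fun i => d i * f (d i)) (A * QIT.mfun f A) := by
    refine ⟨h.1, ?_⟩
    rw [h.mfun_eq f, ← mul_assoc, ← mul_assoc, h.mul, mul_assoc U, Matrix.diagonal_mul_diagonal]
    simp
  exact this.rtr_eq

lemma Diagonalizes.relEnt_eq {U V A B : Matrix n n ℂ} {a b : n → ℝ} (hA : Diagonalizes U a A)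
    (hB : Diagonalizes V b B) :
    relEnt A B = ∑ i, ∑ j, overlap U V i j * (a i * (Real.logb 2 (a i) - Real.logb 2 (b j))) := by
  rw [relEnt, mlog, mlog, hA.rtr_mul_mfun_self, hA.rtr_mul (hB.mfun _), ← Finset.sum_sub_distrib]
  refine Finset.sum_congr rfl fun i _ => ?_
  simp_rw [mul_sub, Finset.sum_sub_distrib]
  rw [← Finset.sum_mul, sum_overlap_right hA.1 hB.1, one_mul]

lemma Diagonalizes.sum_overlap_sub {U V A B : Matrix n n ℂ} {a b : n → ℝ}
    (hA : Diagonalizes U a A) (hB : Diagonalizes V b B) (c : ℝ) :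
    ∑ i, ∑ j, overlap U V i j * (a i - c * b j) = rtr A - c * rtr B := by
  simp_rw [mul_sub, Finset.sum_sub_distrib]
  congr 1
  · simp_rw [← Finset.sum_mul, sum_overlap_right hA.1 hB.1, one_mul]
    exact hA.rtr_eq.symm
  · rw [Finset.sum_comm]
    simp_rw [← Finset.sum_mul, sum_overlap_left hA.1 hB.1, one_mul]
    rw [← Finset.mul_sum, hB.rtr_eq]

end Diagonalization

section RelativeEntropyBounds

variable {n : Type*} [Fintype n] [DecidableEq n]

lemma Diagonalizes.overlap_mul_eq_zero {U V A B : Matrix n n ℂ} {a b : n → ℝ}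
    (hA : Diagonalizes U a A) (hB : Diagonalizes V b B) (h : SuppLE A B) (i : n) {j : n}
    (hj : b j = 0) : a i = 0 ∨ overlap U V i j = 0 := by
  have h1 : B.mulVec (V.col j) = 0 := by
    ext k
    have := congrFun (congrFun hB.mul k) j
    rw [Matrix.mul_diagonal, hj] at this
    have h0 : (B * V) k j = 0 := by simpa using this
    exact h0
  have h2 := h _ h1
  have h3 : (star U * (A * V)) i j = 0 := by
    rw [Matrix.mul_apply]
    refine Finset.sum_eq_zero fun k _ => ?_
    have : (A * V) k j = 0 := congrFun h2 k
    rw [this, mul_zero]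
  rw [← mul_assoc, hA.star_mul, mul_assoc, Matrix.diagonal_mul] at h3
  rcases mul_eq_zero.1 h3 with h4 | h4
  · exact Or.inl (by exact_mod_cast h4)
  · exact Or.inr (by rw [overlap, h4, map_zero])

lemma le_log_two_mul_relEnt {A B : Matrix n n ℂ} (hA : A.PosSemidef) (hB : B.PosSemidef)
    (h : SuppLE A B) {c : ℝ} (hc : 0 < c) :
    rtr A * Real.log c + (rtr A - c * rtr B) ≤ Real.log 2 * relEnt A B := by
  obtain ⟨U, a, hU⟩ := exists_diagonalizes hA.1
  obtain ⟨V, b, hV⟩ := exists_diagonalizes hB.1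
  have ha := hU.nonneg hA
  have hb := hV.nonneg hB
  have e : rtr A * Real.log c = ∑ i, ∑ j, overlap U V i j * (a i * Real.log c) := by
    simp_rw [← Finset.sum_mul, sum_overlap_right hU.1 hV.1, one_mul, ← Finset.sum_mul]
    rw [hU.rtr_eq]
  rw [← hU.sum_overlap_sub hV, hU.relEnt_eq hV, e, ← Finset.sum_add_distrib, Finset.mul_sum]
  refine Finset.sum_le_sum fun i _ => ?_
  rw [← Finset.sum_add_distrib, Finset.mul_sum]
  refine Finset.sum_le_sum fun j _ => ?_
  rw [← mul_add, mul_left_comm]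
  rcases (hb j).eq_or_lt' with hj | hj
  · rcases hU.overlap_mul_eq_zero hV h i hj with h0 | h0 <;> simp [h0, hj]
  refine mul_le_mul_of_nonneg_left ?_ (overlap_nonneg _ _ _ _)
  have l2 : Real.log 2 ≠ 0 := (Real.log_pos one_lt_two).ne'
  have : Real.log 2 * (a i * (Real.logb 2 (a i) - Real.logb 2 (b j)))
      = a i * (Real.log (a i) - Real.log (b j)) := by
    rw [Real.logb, Real.logb]; field_simp
  rw [this]
  rcases (ha i).eq_or_lt' with hi | hi
  · rw [hi]; simp; positivity
  have key := Real.log_le_sub_one_of_pos (show 0 < c * b j / a i by positivity)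
  rw [Real.log_div (by positivity) hi.ne', Real.log_mul hc.ne' hj.ne'] at key
  have := mul_le_mul_of_nonneg_left key hi.le
  have e2 : a i * (c * b j / a i - 1) = c * b j - a i := by field_simp
  nlinarith

/-- Klein's inequality for operators whose traces have ratio `c`. -/
lemma rtr_mul_logb_le_relEnt {A B : Matrix n n ℂ} (hA : A.PosSemidef) (hB : B.PosSemidef)
    (h : SuppLE A B) {c : ℝ} (hc : 0 < c) (ht : rtr A = c * rtr B) :
    rtr A * Real.logb 2 c ≤ relEnt A B := by
  have := le_log_two_mul_relEnt hA hB h hc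
  have l2 := Real.log_pos one_lt_two
  rw [Real.logb, ← mul_div_assoc, div_le_iff₀ l2]
  linarith

omit [DecidableEq n] in
lemma suppLE_of_posSemidef_smul_sub {A B : Matrix n n ℂ} (hA : A.PosSemidef) {l : ℝ}
    (h : ((l : ℂ) • B - A).PosSemidef) : SuppLE A B := by
  intro v hv
  have h1 := h.dotProduct_mulVec_nonneg v
  rw [Matrix.sub_mulVec, Matrix.smul_mulVec, hv, smul_zero, zero_sub, dotProduct_neg] at h1
  have h2 := hA.dotProduct_mulVec_nonneg v
  exact (hA.dotProduct_mulVec_zero_iff v).1 (le_antisymm (by simpa using h1) h2)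

lemma Diagonalizes.dotProduct_mulVec {U A : Matrix n n ℂ} {a : n → ℝ} (hA : Diagonalizes U a A)
    (v : n → ℂ) : star v ⬝ᵥ A.mulVec v
      = ((∑ i, a i * Complex.normSq ((star U).mulVec v i) : ℝ) : ℂ) := by
  rw [hA.2, ← Matrix.mulVec_mulVec, ← Matrix.mulVec_mulVec, Matrix.dotProduct_mulVec]
  have : Matrix.vecMul (star v) U = star ((star U).mulVec v) := by
    rw [Matrix.star_mulVec, Matrix.star_eq_conjTranspose, Matrix.conjTranspose_conjTranspose]
  rw [this, dotProduct]
  push_cast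
  refine Finset.sum_congr rfl fun i _ => ?_
  rw [Matrix.mulVec_diagonal, ← Complex.mul_conj, Pi.star_apply]
  simp only [RCLike.star_def]
  ring

/-- If `A ≤ l B` then each eigenvalue of `A` is dominated by a harmonic mean of those of `B`. -/
lemma Diagonalizes.mul_sum_overlap_div_le {U V A B : Matrix n n ℂ} {a b : n → ℝ}
    (hU : Diagonalizes U a A) (hV : Diagonalizes V b B) (hA : A.PosSemidef) (hB : B.PosSemidef)
    {l : ℝ} (hl : 0 ≤ l) (h : ((l : ℂ) • B - A).PosSemidef) (i : n) :
    a i * ∑ j, overlap U V i j / b j ≤ l := by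
  have ha := hU.nonneg hA
  have hb := hV.nonneg hB
  obtain ⟨t, ht⟩ : ∃ t, t = ∑ j, overlap U V i j / b j := ⟨_, rfl⟩
  have ht0 : 0 ≤ t := ht ▸ Finset.sum_nonneg fun j _ => div_nonneg (overlap_nonneg _ _ _ _) (hb j)
  obtain ⟨y, hy⟩ : ∃ y : n → ℂ, y = fun j => star ((star U * V) i j) / (b j : ℂ) := ⟨_, rfl⟩
  have h1 := h.dotProduct_mulVec_nonneg (V.mulVec y)
  rw [Matrix.sub_mulVec, Matrix.smul_mulVec, dotProduct_sub, dotProduct_smul,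
    hU.dotProduct_mulVec, hV.dotProduct_mulVec, Matrix.mulVec_mulVec, Matrix.mulVec_mulVec,
    Matrix.mem_unitaryGroup_iff'.1 hV.1, Matrix.one_mulVec, sub_nonneg, smul_eq_mul] at h1
  have h2 : ∑ k, a k * Complex.normSq ((star U * V).mulVec y k)
      ≤ l * ∑ j, b j * Complex.normSq (y j) := by exact_mod_cast h1
  have h3 : ∑ j, b j * Complex.normSq (y j) = t := by
    rw [ht]
    refine Finset.sum_congr rfl fun j _ => ?_
    rw [hy, overlap]
    simp only [map_div₀, Complex.normSq_ofReal, RCLike.star_def, Complex.normSq_conj]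
    by_cases h0 : b j = 0
    · simp [h0]
    · field_simp
  have h4 : (star U * V).mulVec y i = (t : ℂ) := by
    rw [ht, Matrix.mulVec, dotProduct]
    push_cast
    refine Finset.sum_congr rfl fun j _ => ?_
    rw [hy, overlap, ← Complex.mul_conj, mul_div_assoc]
    rfl
  have h5 : a i * (t * t) ≤ l * t := by
    rw [h3] at h2
    refine le_trans ?_ h2
    rw [← Complex.normSq_ofReal, ← h4]
    exact Finset.single_le_sum (f := fun k => a k * Complex.normSq ((star U * V).mulVec y k))
      (fun k _ => mul_nonneg (ha k) (Complex.normSq_nonneg _)) (Finset.mem_univ i)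
  rw [← ht]
  rcases ht0.eq_or_lt' with h0 | h0
  · rw [h0, mul_zero]; exact hl
  · nlinarith

/-- If `A ≤ l B`, then `D(A‖B) ≤ Tr A · log l`. -/
lemma relEnt_le_of_posSemidef_smul_sub {A B : Matrix n n ℂ} (hA : A.PosSemidef)
    (hB : B.PosSemidef) {l : ℝ} (hl : 0 < l) (h : ((l : ℂ) • B - A).PosSemidef) :
    relEnt A B ≤ rtr A * Real.logb 2 l := by
  have hs := suppLE_of_posSemidef_smul_sub hA h
  obtain ⟨U, a, hU⟩ := exists_diagonalizes hA.1
  obtain ⟨V, b, hV⟩ := exists_diagonalizes hB.1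
  have ha := hU.nonneg hA
  have hb := hV.nonneg hB
  have l2 := Real.log_pos one_lt_two
  rw [hU.relEnt_eq hV, hU.rtr_eq, Finset.sum_mul]
  refine Finset.sum_le_sum fun i _ => ?_
  rcases (ha i).eq_or_lt' with hi | hi
  · simp [hi]
  have key := hU.mul_sum_overlap_div_le hV hA hB hl.le h i
  have e1 : a i * Real.logb 2 l = ∑ j, overlap U V i j * (a i * Real.logb 2 l) := by
    rw [← Finset.sum_mul, sum_overlap_right hU.1 hV.1, one_mul]
  rw [← sub_nonneg, e1, ← Finset.sum_sub_distrib]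
  have hterm : ∀ j, a i / Real.log 2 * (overlap U V i j - a i / l * (overlap U V i j / b j))
      ≤ overlap U V i j * (a i * Real.logb 2 l)
        - overlap U V i j * (a i * (Real.logb 2 (a i) - Real.logb 2 (b j))) := by
    intro j
    rcases (hb j).eq_or_lt' with hj | hj
    · rcases hU.overlap_mul_eq_zero hV hs i hj with h0 | h0
      · exact absurd h0 hi.ne'
      · simp [h0]
    have k := Real.log_le_sub_one_of_pos (show 0 < a i / (l * b j) by positivity)
    rw [Real.log_div hi.ne' (by positivity), Real.log_mul hl.ne' hj.ne'] at k
    have e2 : overlap U V i j * (a i * Real.logb 2 l)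
        - overlap U V i j * (a i * (Real.logb 2 (a i) - Real.logb 2 (b j)))
        = overlap U V i j * a i / Real.log 2
          * (Real.log l + Real.log (b j) - Real.log (a i)) := by
      simp only [Real.logb]; field_simp; ring
    have e3 : a i / Real.log 2 * (overlap U V i j - a i / l * (overlap U V i j / b j))
        = overlap U V i j * a i / Real.log 2 * (1 - a i / (l * b j)) := by
      field_simp
    rw [e2, e3]
    have hw := overlap_nonneg U V i j
    exact mul_le_mul_of_nonneg_left (by linarith) (by positivity)
  refine le_trans ?_ (Finset.sum_le_sum fun j _ => hterm j)
  rw [← Finset.mul_sum, Finset.sum_sub_distrib, ← Finset.mul_sum, sum_overlap_right hU.1 hV.1]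
  refine mul_nonneg (by positivity) ?_
  rw [sub_nonneg, div_mul_eq_mul_div, div_le_one hl]
  exact key

end RelativeEntropyBounds

section JointConvexity

open MeasureTheory

/-- The scalar identity behind the integral representation of the relative entropy. -/
lemma intervalIntegrable_and_integral_sq_div {a b : ℝ} (ha : 0 ≤ a) (hb : 0 < b) :
    IntervalIntegrable (fun s : ℝ => (1 - s) * ((a - b) ^ 2 / (s * a + (1 - s) * b))) volume 0 1 ∧
    ∫ s in (0 : ℝ)..1, (1 - s) * ((a - b) ^ 2 / (s * a + (1 - s) * b))
      = a * (Real.log a - Real.log b) - (a - b) := by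
  rcases ha.eq_or_lt' with h0 | h0
  · have h : Set.EqOn (fun s : ℝ => (1 - s) * ((a - b) ^ 2 / (s * a + (1 - s) * b)))
        (fun _ => b) (Set.Ioo 0 1) := by
      intro s hs
      have : (1 - s) ≠ 0 := by linarith [hs.2]
      simp only [h0]
      field_simp
      ring
    refine ⟨?_, ?_⟩
    · rw [intervalIntegrable_congr_uIoo (g := fun _ => b)]
      · exact intervalIntegrable_const
      · rwa [Set.uIoo_of_le zero_le_one]
    · rw [intervalIntegral.integral_congr_Ioo_of_le zero_le_one h]
      simp [h0]
  · have hq : ∀ s ∈ Set.uIcc (0 : ℝ) 1, 0 < s * a + (1 - s) * b := by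
      intro s hs
      rw [Set.uIcc_of_le zero_le_one] at hs
      rcases hs.1.eq_or_lt' with h1 | h1
      · simp [h1, hb]
      · have := mul_nonneg (sub_nonneg.2 hs.2) hb.le
        positivity
    have hcont : ContinuousOn
        (fun s : ℝ => (1 - s) * ((a - b) ^ 2 / (s * a + (1 - s) * b))) (Set.uIcc 0 1) := by
      refine ContinuousOn.mul (by fun_prop) (ContinuousOn.div (by fun_prop) (by fun_prop) ?_)
      exact fun s hs => (hq s hs).ne'
    refine ⟨hcont.intervalIntegrable, ?_⟩
    rw [intervalIntegral.integral_eq_sub_of_hasDerivAt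
      (f := fun s => a * Real.log (s * a + (1 - s) * b) - (a - b) * s) ?_ hcont.intervalIntegrable]
    · simp; ring
    · intro s hs
      have h1 : HasDerivAt (fun s : ℝ => s * a + (1 - s) * b) (1 * a + (0 - 1) * b) s :=
        ((hasDerivAt_id s).mul_const a).add
          (((hasDerivAt_const s (1 : ℝ)).sub (hasDerivAt_id s)).mul_const b)
      have h2 := ((h1.log (hq s hs).ne').const_mul a).sub ((hasDerivAt_id s).const_mul (a - b))
      refine HasDerivAt.congr_deriv (f := fun s : ℝ =>
        a * Real.log (s * a + (1 - s) * b) - (a - b) * s) h2 ?_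
      have hne := (hq s hs).ne'
      generalize hr : s * a + (1 - s) * b = r at hne
      field_simp
      rw [← hr]
      ring

variable {n : Type*} [Fintype n] [DecidableEq n]

/-- The quadratic form `⟨A - B, (s L_A + (1 - s) R_B)⁻¹ (A - B)⟩` in eigenbases. -/
def quadDiv (U V : Matrix n n ℂ) (a b : n → ℝ) (s : ℝ) : ℝ :=
  ∑ i, ∑ j, overlap U V i j * ((a i - b j) ^ 2 / (s * a i + (1 - s) * b j))

lemma Diagonalizes.intervalIntegrable_and_integral_quadDiv {U V A B : Matrix n n ℂ} {a b : n → ℝ}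
    (hU : Diagonalizes U a A) (hV : Diagonalizes V b B) (hA : A.PosSemidef) (hB : B.PosSemidef)
    (h : SuppLE A B) :
    IntervalIntegrable (fun s => (1 - s) * quadDiv U V a b s) volume 0 1 ∧
    ∫ s in (0 : ℝ)..1, (1 - s) * quadDiv U V a b s
      = Real.log 2 * relEnt A B - (rtr A - rtr B) := by
  have ha := hU.nonneg hA
  have hb := hV.nonneg hB
  have key : ∀ i j,
      IntervalIntegrable (fun s : ℝ => overlap U V i j *
        ((1 - s) * ((a i - b j) ^ 2 / (s * a i + (1 - s) * b j)))) volume 0 1 ∧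
      ∫ s in (0 : ℝ)..1, overlap U V i j *
        ((1 - s) * ((a i - b j) ^ 2 / (s * a i + (1 - s) * b j)))
      = overlap U V i j * (a i * (Real.log (a i) - Real.log (b j)) - (a i - b j)) := by
    intro i j
    rcases (hb j).eq_or_lt' with hj | hj
    · rcases hU.overlap_mul_eq_zero hV h i hj with h0 | h0
      · simp [hj, h0]
      · simp [h0]
    · obtain ⟨h1, h2⟩ := intervalIntegrable_and_integral_sq_div (ha i) hj
      exact ⟨h1.const_mul _, by rw [intervalIntegral.integral_const_mul, h2]⟩
  have e : (fun s => (1 - s) * quadDiv U V a b s) = fun s => ∑ i, ∑ j, overlap U V i j *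
        ((1 - s) * ((a i - b j) ^ 2 / (s * a i + (1 - s) * b j))) := by
    ext s
    simp only [quadDiv, Finset.mul_sum, mul_left_comm (1 - s)]
  have hint : ∀ i, IntervalIntegrable (fun s : ℝ => ∑ j, overlap U V i j *
        ((1 - s) * ((a i - b j) ^ 2 / (s * a i + (1 - s) * b j)))) volume 0 1 := fun i => by
    have := IntervalIntegrable.sum Finset.univ (fun j _ => (key i j).1)
    simpa [Finset.sum_fn] using this
  rw [e]
  refine ⟨?_, ?_⟩
  · have := IntervalIntegrable.sum Finset.univ (fun i _ => hint i)
    simpa [Finset.sum_fn] using this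
  · rw [intervalIntegral.integral_finsetSum fun i _ => hint i]
    have e2 : ∀ i, (∫ s in (0 : ℝ)..1, ∑ j, overlap U V i j *
        ((1 - s) * ((a i - b j) ^ 2 / (s * a i + (1 - s) * b j))))
        = ∑ j, overlap U V i j * (a i * (Real.log (a i) - Real.log (b j)) - (a i - b j)) := by
      intro i
      rw [intervalIntegral.integral_finsetSum fun j _ => (key i j).1]
      exact Finset.sum_congr rfl fun j _ => (key i j).2
    simp_rw [e2]
    have e3 := hU.sum_overlap_sub hV 1
    simp only [one_mul] at e3
    rw [hU.relEnt_eq hV, ← e3, Finset.mul_sum, ← Finset.sum_sub_distrib]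
    refine Finset.sum_congr rfl fun i _ => ?_
    rw [Finset.mul_sum, ← Finset.sum_sub_distrib]
    refine Finset.sum_congr rfl fun j _ => ?_
    have l2 := (Real.log_pos one_lt_two).ne'
    simp only [Real.logb]
    field_simp

/-- The concave functional of `Y` whose maximum is `quadDiv`; it is linear in `(A, B)`. -/
def dualDiv (s : ℝ) (Y A B : Matrix n n ℂ) : ℝ :=
  2 * rtr (star Y * (A - B)) - s * rtr (star Y * (A * Y)) - (1 - s) * rtr (Y * (B * star Y))

omit [DecidableEq n] in
lemma dualDiv_add (s : ℝ) (Y A₁ A₂ B₁ B₂ : Matrix n n ℂ) :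
    dualDiv s Y (A₁ + A₂) (B₁ + B₂) = dualDiv s Y A₁ B₁ + dualDiv s Y A₂ B₂ := by
  simp only [dualDiv, rtr, mul_add, add_mul, mul_sub, Matrix.trace_add, Matrix.trace_sub,
    Complex.add_re, Complex.sub_re]
  ring

omit [DecidableEq n] in
lemma rtr_star_mul (Y Z : Matrix n n ℂ) :
    rtr (star Y * Z) = ∑ i, ∑ j, (star (Y i j) * Z i j).re := by
  rw [rtr, Matrix.trace, Complex.re_sum, Finset.sum_comm]
  refine Finset.sum_congr rfl fun i _ => ?_
  rw [Matrix.diag_apply, Matrix.mul_apply, Complex.re_sum]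
  rfl

lemma Diagonalizes.dualDiv_eq {U V A B : Matrix n n ℂ} {a b : n → ℝ}
    (hU : Diagonalizes U a A) (hV : Diagonalizes V b B) (s : ℝ) (y : Matrix n n ℂ) :
    dualDiv s (U * y * star V) A B = ∑ i, ∑ j,
      (2 * (a i - b j) * (star (y i j) * (star U * V) i j).re
        - (s * a i + (1 - s) * b j) * Complex.normSq (y i j)) := by
  have hUU := Matrix.mem_unitaryGroup_iff'.1 hU.1
  have hVV := Matrix.mem_unitaryGroup_iff'.1 hV.1
  have e1 : rtr (star (U * y * star V) * (A - B)) = ∑ i, ∑ j,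
      (a i - b j) * (star (y i j) * (star U * V) i j).re := by
    have : rtr (star (U * y * star V) * (A - B)) = rtr (star y * (star U * (A - B) * V)) := by
      rw [rtr, rtr]
      simp only [StarMul.star_mul, star_star]
      rw [mul_assoc V, Matrix.trace_mul_comm]
      simp only [mul_assoc]
    have hZ : star U * (A - B) * V = Matrix.diagonal (fun i => (a i : ℂ)) * (star U * V)
        - star U * V * Matrix.diagonal (fun i => (b i : ℂ)) := by
      rw [mul_sub, hU.star_mul, sub_mul, mul_assoc (star U) B, hV.mul]
      simp only [mul_assoc]
    rw [this, rtr_star_mul, hZ]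
    refine Finset.sum_congr rfl fun i _ => Finset.sum_congr rfl fun j _ => ?_
    rw [Matrix.sub_apply, Matrix.diagonal_mul, Matrix.mul_diagonal,
      show star (y i j) * ((a i : ℂ) * (star U * V) i j - (star U * V) i j * (b j : ℂ))
        = ((a i - b j : ℝ) : ℂ) * (star (y i j) * (star U * V) i j) by push_cast; ring,
      Complex.re_ofReal_mul]
  have e2 : rtr (star (U * y * star V) * (A * (U * y * star V))) = ∑ i, ∑ j,
      a i * Complex.normSq (y i j) := by
    have : rtr (star (U * y * star V) * (A * (U * y * star V)))
        = rtr (star y * (Matrix.diagonal (fun i => (a i : ℂ)) * y)) := by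
      rw [← hU.star_mul_mul, rtr, rtr]
      simp only [StarMul.star_mul, star_star]
      rw [mul_assoc V, Matrix.trace_mul_comm]
      simp only [mul_assoc, hVV, mul_one]
    rw [this, rtr_star_mul]
    refine Finset.sum_congr rfl fun i _ => Finset.sum_congr rfl fun j _ => ?_
    rw [Matrix.diagonal_mul, mul_left_comm, Complex.re_ofReal_mul, mul_comm (star _),
      RCLike.star_def, Complex.mul_conj, Complex.ofReal_re]
  have e3 : rtr ((U * y * star V) * (B * star (U * y * star V))) = ∑ i, ∑ j,
      b j * Complex.normSq (y i j) := by
    have : rtr ((U * y * star V) * (B * star (U * y * star V)))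
        = rtr (star y * (y * Matrix.diagonal (fun i => (b i : ℂ)))) := by
      rw [← hV.star_mul_mul, rtr, rtr, Matrix.trace_mul_comm (star y)]
      simp only [StarMul.star_mul, star_star]
      rw [mul_assoc U y, mul_assoc U, Matrix.trace_mul_comm]
      simp only [mul_assoc, hUU, mul_one]
    rw [this, rtr_star_mul]
    refine Finset.sum_congr rfl fun i _ => Finset.sum_congr rfl fun j _ => ?_
    rw [Matrix.mul_diagonal, ← mul_assoc, mul_comm, Complex.re_ofReal_mul, mul_comm (star _),
      RCLike.star_def, Complex.mul_conj, Complex.ofReal_re]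
  rw [dualDiv, e1, e2, e3]
  simp only [Finset.mul_sum, ← Finset.sum_sub_distrib]
  refine Finset.sum_congr rfl fun i _ => Finset.sum_congr rfl fun j _ => ?_
  ring

lemma two_mul_sub_le_normSq_mul_div {x q : ℝ} (hq : 0 ≤ q) (hx : q = 0 → x = 0) (y w : ℂ) :
    2 * x * (star y * w).re - q * Complex.normSq y ≤ Complex.normSq w * (x ^ 2 / q) := by
  rcases hq.eq_or_lt' with h0 | h0
  · simp [h0, hx h0]
  · rw [← mul_div_assoc, le_div_iff₀ h0, Complex.normSq_apply, Complex.normSq_apply]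
    simp only [RCLike.star_def, Complex.mul_re, Complex.conj_re, Complex.conj_im]
    nlinarith [sq_nonneg (q * y.re - x * w.re), sq_nonneg (q * y.im - x * w.im)]

lemma two_mul_sub_eq_normSq_mul_div {x q : ℝ} (hx : q = 0 → x = 0) (w : ℂ) :
    2 * x * (star (w * ((x / q : ℝ) : ℂ)) * w).re - q * Complex.normSq (w * ((x / q : ℝ) : ℂ))
      = Complex.normSq w * (x ^ 2 / q) := by
  by_cases h0 : q = 0
  · simp [h0, hx h0]
  · have e : star (w * ((x / q : ℝ) : ℂ)) * w = ((Complex.normSq w * (x / q) : ℝ) : ℂ) := by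
      rw [star_mul', RCLike.star_def, Complex.conj_ofReal, Complex.ofReal_mul, ← Complex.mul_conj]
      ring
    rw [e, Complex.ofReal_re, Complex.normSq_mul, Complex.normSq_ofReal]
    field_simp
    ring

lemma Diagonalizes.dualDiv_le {U V A B : Matrix n n ℂ} {a b : n → ℝ}
    (hU : Diagonalizes U a A) (hV : Diagonalizes V b B) (hA : A.PosSemidef) (hB : B.PosSemidef)
    {s : ℝ} (hs : s ∈ Set.Ioo (0 : ℝ) 1) (Y : Matrix n n ℂ) :
    dualDiv s Y A B ≤ quadDiv U V a b s := by
  have hY : Y = U * (star U * Y * V) * star V := by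
    simp only [mul_assoc, Matrix.mem_unitaryGroup_iff.1 hV.1, mul_one]
    rw [← mul_assoc, Matrix.mem_unitaryGroup_iff.1 hU.1, one_mul]
  rw [hY, hU.dualDiv_eq hV]
  refine Finset.sum_le_sum fun i _ => Finset.sum_le_sum fun j _ => ?_
  have h1 := mul_nonneg hs.1.le (hU.nonneg hA i)
  have h2 := mul_nonneg (sub_nonneg.2 hs.2.le) (hV.nonneg hB j)
  refine two_mul_sub_le_normSq_mul_div (by positivity) (fun h => ?_) _ _
  have h3 : s * a i = 0 := by linarith
  have h4 : (1 - s) * b j = 0 := by linarith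
  rw [(mul_eq_zero.1 h3).resolve_left hs.1.ne',
    (mul_eq_zero.1 h4).resolve_left (sub_pos.2 hs.2).ne', sub_zero]

lemma Diagonalizes.exists_dualDiv_eq {U V A B : Matrix n n ℂ} {a b : n → ℝ}
    (hU : Diagonalizes U a A) (hV : Diagonalizes V b B) (hA : A.PosSemidef) (hB : B.PosSemidef)
    {s : ℝ} (hs : s ∈ Set.Ioo (0 : ℝ) 1) :
    ∃ Y, dualDiv s Y A B = quadDiv U V a b s := by
  refine ⟨U * (Matrix.of fun i j => (star U * V) i j *
    (((a i - b j) / (s * a i + (1 - s) * b j) : ℝ) : ℂ)) * star V, ?_⟩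
  rw [hU.dualDiv_eq hV]
  refine Finset.sum_congr rfl fun i _ => Finset.sum_congr rfl fun j _ => ?_
  have h1 := mul_nonneg hs.1.le (hU.nonneg hA i)
  have h2 := mul_nonneg (sub_nonneg.2 hs.2.le) (hV.nonneg hB j)
  refine two_mul_sub_eq_normSq_mul_div (fun h => ?_) _
  have h3 : s * a i = 0 := by linarith
  have h4 : (1 - s) * b j = 0 := by linarith
  rw [(mul_eq_zero.1 h3).resolve_left hs.1.ne',
    (mul_eq_zero.1 h4).resolve_left (sub_pos.2 hs.2).ne', sub_zero]

omit [DecidableEq n] in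
lemma rtr_add (A B : Matrix n n ℂ) : rtr (A + B) = rtr A + rtr B := by
  simp [rtr, Matrix.trace_add]

omit [DecidableEq n] in
lemma SuppLE.add {A₁ A₂ B₁ B₂ : Matrix n n ℂ} (hB₁ : B₁.PosSemidef) (hB₂ : B₂.PosSemidef)
    (h₁ : SuppLE A₁ B₁) (h₂ : SuppLE A₂ B₂) : SuppLE (A₁ + A₂) (B₁ + B₂) := by
  intro v hv
  have e : star v ⬝ᵥ B₁.mulVec v + star v ⬝ᵥ B₂.mulVec v = 0 := by
    rw [← dotProduct_add, ← Matrix.add_mulVec, hv, dotProduct_zero]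
  have p₁ := hB₁.dotProduct_mulVec_nonneg v
  have p₂ := hB₂.dotProduct_mulVec_nonneg v
  obtain ⟨z₁, z₂⟩ := (add_eq_zero_iff_of_nonneg p₁ p₂).1 e
  rw [Matrix.add_mulVec, h₁ v ((hB₁.dotProduct_mulVec_zero_iff v).1 z₁),
    h₂ v ((hB₂.dotProduct_mulVec_zero_iff v).1 z₂), add_zero]

/-- Joint subadditivity (equivalently, joint convexity) of the relative entropy. -/
theorem relEnt_add_le {A₁ A₂ B₁ B₂ : Matrix n n ℂ} (hA₁ : A₁.PosSemidef) (hA₂ : A₂.PosSemidef)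
    (hB₁ : B₁.PosSemidef) (hB₂ : B₂.PosSemidef) (h₁ : SuppLE A₁ B₁) (h₂ : SuppLE A₂ B₂) :
    relEnt (A₁ + A₂) (B₁ + B₂) ≤ relEnt A₁ B₁ + relEnt A₂ B₂ := by
  obtain ⟨U, a, hU⟩ := exists_diagonalizes (hA₁.add hA₂).1
  obtain ⟨V, b, hV⟩ := exists_diagonalizes (hB₁.add hB₂).1
  obtain ⟨U₁, a₁, hU₁⟩ := exists_diagonalizes hA₁.1
  obtain ⟨V₁, b₁, hV₁⟩ := exists_diagonalizes hB₁.1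
  obtain ⟨U₂, a₂, hU₂⟩ := exists_diagonalizes hA₂.1
  obtain ⟨V₂, b₂, hV₂⟩ := exists_diagonalizes hB₂.1
  obtain ⟨i, e⟩ := hU.intervalIntegrable_and_integral_quadDiv hV (hA₁.add hA₂) (hB₁.add hB₂)
    (h₁.add hB₁ hB₂ h₂)
  obtain ⟨i₁, e₁⟩ := hU₁.intervalIntegrable_and_integral_quadDiv hV₁ hA₁ hB₁ h₁
  obtain ⟨i₂, e₂⟩ := hU₂.intervalIntegrable_and_integral_quadDiv hV₂ hA₂ hB₂ h₂
  have key := intervalIntegral.integral_mono_on_of_le_Ioo zero_le_one i (i₁.add i₂) fun s hs => by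
    obtain ⟨Y, hY⟩ := hU.exists_dualDiv_eq hV (hA₁.add hA₂) (hB₁.add hB₂) hs
    rw [← hY, dualDiv_add, ← mul_add]
    exact mul_le_mul_of_nonneg_left (add_le_add (hU₁.dualDiv_le hV₁ hA₁ hB₁ hs Y)
      (hU₂.dualDiv_le hV₂ hA₂ hB₂ hs Y)) (sub_nonneg.2 hs.2.le)
  rw [intervalIntegral.integral_add i₁ i₂, e, e₁, e₂, rtr_add, rtr_add] at key
  have l2 := Real.log_pos one_lt_two
  refine le_of_mul_le_mul_left ?_ l2
  linarith

end JointConvexity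

section ConditionalEntropy

variable {b r : Type*} [Fintype b] [DecidableEq b] [Fintype r] [DecidableEq r]

omit [DecidableEq b] [Fintype r] [DecidableEq r] in
lemma ptraceA_add (X Y : Matrix (b × r) (b × r) ℂ) :
    ptraceA (X + Y) = ptraceA X + ptraceA Y := by
  ext i j
  simp [ptraceA, Finset.sum_add_distrib]

omit [DecidableEq b] [Fintype r] [DecidableEq r] in
lemma ptraceA_eq_sum (X : Matrix (b × r) (b × r) ℂ) :
    ptraceA X = ∑ k : b, X.submatrix (fun i => (k, i)) (fun i => (k, i)) := by
  ext i j
  simp [ptraceA, Matrix.sum_apply]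

omit [DecidableEq b] [DecidableEq r] in
lemma trace_ptraceA (X : Matrix (b × r) (b × r) ℂ) : (ptraceA X).trace = X.trace := by
  simp only [Matrix.trace, Matrix.diag_apply, ptraceA, Matrix.of_apply]
  rw [Fintype.sum_prod_type, Finset.sum_comm]

omit [DecidableEq b] [DecidableEq r] in
lemma rtr_ptraceA (X : Matrix (b × r) (b × r) ℂ) : rtr (ptraceA X) = rtr X := by
  rw [rtr, trace_ptraceA, rtr]

omit [DecidableEq b] [Fintype r] [DecidableEq r] in
lemma posSemidef_ptraceA {X : Matrix (b × r) (b × r) ℂ} (hX : X.PosSemidef) :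
    (ptraceA X).PosSemidef := by
  rw [ptraceA_eq_sum]
  exact Matrix.posSemidef_sum _ fun k _ => hX.submatrix _

omit [DecidableEq r] in
lemma posSemidef_one_kronecker {Z : Matrix r r ℂ} (hZ : Z.PosSemidef) :
    ((1 : Matrix b b ℂ) ⊗ₖ Z).PosSemidef := Matrix.PosSemidef.one.kronecker hZ

omit [DecidableEq r] in
lemma rtr_mul_one_kronecker (X : Matrix (b × r) (b × r) ℂ) (Z : Matrix r r ℂ) :
    rtr (X * ((1 : Matrix b b ℂ) ⊗ₖ Z)) = rtr (ptraceA X * Z) := by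
  rw [rtr, rtr]
  congr 1
  simp only [Matrix.trace, Matrix.diag_apply, Matrix.mul_apply, ptraceA, Matrix.of_apply,
    Matrix.kronecker_apply, Fintype.sum_prod_type, Finset.sum_mul, Matrix.one_apply]
  rw [Finset.sum_comm]
  refine Finset.sum_congr rfl fun i _ => ?_
  rw [Finset.sum_comm]
  simp [Finset.sum_comm (γ := b)]

omit [DecidableEq r] in
lemma rtr_one_kronecker (Z : Matrix r r ℂ) :
    rtr ((1 : Matrix b b ℂ) ⊗ₖ Z) = Fintype.card b * rtr Z := by
  rw [rtr, Matrix.trace_kronecker, Matrix.trace_one, rtr, ← Complex.ofReal_natCast,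
    Complex.re_ofReal_mul]

lemma Diagonalizes.smul_one_kronecker {U Z : Matrix r r ℂ} {d : r → ℝ} (h : Diagonalizes U d Z)
    (c : ℝ) : Diagonalizes ((1 : Matrix b b ℂ) ⊗ₖ U) (fun p => c * d p.2)
      ((c : ℂ) • ((1 : Matrix b b ℂ) ⊗ₖ Z)) := by
  have hs : star ((1 : Matrix b b ℂ) ⊗ₖ U) = (1 : Matrix b b ℂ) ⊗ₖ star U := by
    rw [Matrix.star_eq_conjTranspose, Matrix.conjTranspose_kronecker, Matrix.conjTranspose_one,
      Matrix.star_eq_conjTranspose]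
  have hd : Matrix.diagonal (fun p : b × r => ((c * d p.2 : ℝ) : ℂ))
      = (c : ℂ) • ((1 : Matrix b b ℂ) ⊗ₖ Matrix.diagonal (fun i => (d i : ℂ))) := by
    rw [← Matrix.diagonal_one, Matrix.diagonal_kronecker_diagonal, ← Matrix.diagonal_smul]
    congr 1
    ext p
    simp
  refine ⟨?_, ?_⟩
  · rw [Matrix.mem_unitaryGroup_iff, hs, ← Matrix.mul_kronecker_mul,
      Matrix.mem_unitaryGroup_iff.1 h.1, mul_one, Matrix.one_kronecker_one]
  · rw [hs, hd, Matrix.mul_smul, Matrix.smul_mul, ← Matrix.mul_kronecker_mul,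
      ← Matrix.mul_kronecker_mul, ← h.2, one_mul, one_mul]

lemma mfun_smul_one_kronecker {Z : Matrix r r ℂ} (hZ : Z.IsHermitian) (c : ℝ) (f : ℝ → ℝ) :
    mfun f ((c : ℂ) • ((1 : Matrix b b ℂ) ⊗ₖ Z))
      = (1 : Matrix b b ℂ) ⊗ₖ mfun (fun x => f (c * x)) Z := by
  obtain ⟨U, d, h⟩ := exists_diagonalizes hZ
  have h1 := (h.mfun (fun x => f (c * x))).smul_one_kronecker (b := b) 1
  simp only [one_mul, Complex.ofReal_one, one_smul] at h1
  rw [(h.smul_one_kronecker (b := b) c).mfun_eq, h1.2]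

lemma relEnt_one_kronecker_ptraceA {X : Matrix (b × r) (b × r) ℂ} (hX : X.PosSemidef) :
    relEnt X ((1 : Matrix b b ℂ) ⊗ₖ ptraceA X) = - condvnEnt X := by
  have h := mfun_smul_one_kronecker (b := b) (posSemidef_ptraceA hX).1 1 (Real.logb 2)
  simp only [one_mul, Complex.ofReal_one, one_smul] at h
  rw [relEnt, mlog, mlog, h, rtr_mul_one_kronecker, condvnEnt, vnEnt, vnEnt, mlog, mlog]
  ring

omit [DecidableEq b] [DecidableEq r] in
lemma dotProduct_conjTranspose_mul_self_mulVec (C : Matrix b r ℂ) (v : r → ℂ) :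
    star v ⬝ᵥ (C.conjTranspose * C).mulVec v
      = ((∑ p, Complex.normSq (C.mulVec v p) : ℝ) : ℂ) := by
  rw [← Matrix.mulVec_mulVec, Matrix.dotProduct_mulVec, ← Matrix.star_mulVec, dotProduct]
  push_cast
  refine Finset.sum_congr rfl fun i _ => ?_
  rw [← Complex.mul_conj, Pi.star_apply, mul_comm]
  rfl

lemma exists_conjTranspose_mul_self {X : Matrix r r ℂ} (hX : X.PosSemidef) :
    ∃ C : Matrix r r ℂ, X = C.conjTranspose * C := by
  obtain ⟨U, d, h⟩ := exists_diagonalizes hX.1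
  refine ⟨Matrix.diagonal (fun i => ((Real.sqrt (d i) : ℝ) : ℂ)) * star U, ?_⟩
  rw [h.2, Matrix.conjTranspose_mul, ← Matrix.star_eq_conjTranspose, star_star,
    Matrix.diagonal_conjTranspose, mul_assoc, mul_assoc,
    ← mul_assoc (Matrix.diagonal _) (Matrix.diagonal _), Matrix.diagonal_mul_diagonal]
  congr 3
  ext i
  simp only [Pi.star_apply, RCLike.star_def, Complex.conj_ofReal]
  rw [← Complex.ofReal_mul, Real.mul_self_sqrt (h.nonneg hX i)]

lemma posSemidef_card_smul_one_kronecker_ptraceA_sub {X : Matrix (b × r) (b × r) ℂ}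
    (hX : X.PosSemidef) :
    ((((Fintype.card b : ℝ) : ℂ)) • ((1 : Matrix b b ℂ) ⊗ₖ ptraceA X) - X).PosSemidef := by
  have hY : ((((Fintype.card b : ℝ) : ℂ)) • ((1 : Matrix b b ℂ) ⊗ₖ ptraceA X)).PosSemidef := by
    refine (posSemidef_one_kronecker (posSemidef_ptraceA hX)).smul ?_
    exact_mod_cast Nat.zero_le _
  refine .of_dotProduct_mulVec_nonneg (hY.1.sub hX.1) fun v => ?_
  rw [Matrix.sub_mulVec, dotProduct_sub, sub_nonneg]
  obtain ⟨C, rfl⟩ := exists_conjTranspose_mul_self hX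
  obtain ⟨g, hg⟩ : ∃ g : b → b → b × r → ℂ, g = fun l k =>
      (C.submatrix id (fun i => (l, i))).mulVec (fun i => v (k, i)) := ⟨_, rfl⟩
  have h1 : C.mulVec v = fun p => ∑ k, g k k p := by
    ext p
    simp [hg, Matrix.mulVec, dotProduct, Fintype.sum_prod_type]
  have h2 : star v ⬝ᵥ ((1 : Matrix b b ℂ) ⊗ₖ ptraceA (C.conjTranspose * C)).mulVec v
      = ((∑ k, ∑ l, ∑ p, Complex.normSq (g l k p) : ℝ) : ℂ) := by
    have h3 : ∀ k, ((∑ l, ∑ p, Complex.normSq (g l k p) : ℝ) : ℂ)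
        = star (fun i => v (k, i)) ⬝ᵥ (ptraceA (C.conjTranspose * C)).mulVec (fun i => v (k, i)) := by
      intro k
      rw [ptraceA_eq_sum, Matrix.sum_mulVec, dotProduct_sum, Complex.ofReal_sum]
      refine Finset.sum_congr rfl fun l _ => ?_
      rw [hg, ← dotProduct_conjTranspose_mul_self_mulVec]
      rfl
    rw [Complex.ofReal_sum]
    simp_rw [h3]
    simp [dotProduct, Matrix.mulVec, Fintype.sum_prod_type, Matrix.one_apply, Finset.mul_sum]
  rw [Matrix.smul_mulVec, dotProduct_smul, h2, dotProduct_conjTranspose_mul_self_mulVec,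
    smul_eq_mul, ← Complex.ofReal_mul, Complex.real_le_real, h1]
  have h4 : ∀ p, Complex.normSq (∑ k, g k k p)
      ≤ Fintype.card b * ∑ k, Complex.normSq (g k k p) := by
    intro p
    simp only [← Complex.sq_norm]
    refine le_trans (pow_le_pow_left₀ (norm_nonneg _) (norm_sum_le _ _) 2) ?_
    exact sq_sum_le_card_mul_sum_sq
  refine le_trans (Finset.sum_le_sum fun p _ => h4 p) ?_
  rw [← Finset.mul_sum, Finset.sum_comm]
  refine mul_le_mul_of_nonneg_left (Finset.sum_le_sum fun k _ => ?_) (Nat.cast_nonneg _)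
  exact Finset.single_le_sum (f := fun l => ∑ p, Complex.normSq (g l k p))
    (fun l _ => Finset.sum_nonneg fun p _ => Complex.normSq_nonneg _) (Finset.mem_univ k)

end ConditionalEntropy

section AlickiFannesWinter

variable {n b r : Type*} [Fintype n] [DecidableEq n] [Fintype b] [DecidableEq b]
  [Fintype r] [DecidableEq r]

omit [DecidableEq n] in
lemma suppLE_one_kronecker_ptraceA {X : Matrix (b × r) (b × r) ℂ} (hX : X.PosSemidef) :
    SuppLE X ((1 : Matrix b b ℂ) ⊗ₖ ptraceA X) :=
  suppLE_of_posSemidef_smul_sub hX (posSemidef_card_smul_one_kronecker_ptraceA_sub hX)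

lemma condvnEnt_add_le {X Y : Matrix (b × r) (b × r) ℂ} (hX : X.PosSemidef) (hY : Y.PosSemidef) :
    condvnEnt X + condvnEnt Y ≤ condvnEnt (X + Y) := by
  have h := relEnt_add_le hX hY (posSemidef_one_kronecker (b := b) (posSemidef_ptraceA hX))
    (posSemidef_one_kronecker (posSemidef_ptraceA hY)) (suppLE_one_kronecker_ptraceA hX)
    (suppLE_one_kronecker_ptraceA hY)
  rw [← Matrix.kronecker_add, ← ptraceA_add, relEnt_one_kronecker_ptraceA (hX.add hY),
    relEnt_one_kronecker_ptraceA hX, relEnt_one_kronecker_ptraceA hY] at h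
  linarith

lemma condvnEnt_le [Nonempty b] {X : Matrix (b × r) (b × r) ℂ} (hX : X.PosSemidef) :
    condvnEnt X ≤ rtr X * Real.logb 2 (Fintype.card b) := by
  have hb : (0 : ℝ) < Fintype.card b := by exact_mod_cast Fintype.card_pos
  have h := rtr_mul_logb_le_relEnt hX (posSemidef_one_kronecker (b := b) (posSemidef_ptraceA hX))
    (suppLE_one_kronecker_ptraceA hX) (inv_pos.2 hb)
    (by rw [rtr_one_kronecker, rtr_ptraceA, inv_mul_cancel_left₀ hb.ne'])
  rw [relEnt_one_kronecker_ptraceA hX, Real.logb_inv] at h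
  linarith

lemma neg_le_condvnEnt [Nonempty b] {X : Matrix (b × r) (b × r) ℂ} (hX : X.PosSemidef) :
    - (rtr X * Real.logb 2 (Fintype.card b)) ≤ condvnEnt X := by
  have hb : (0 : ℝ) < Fintype.card b := by exact_mod_cast Fintype.card_pos
  have h := relEnt_le_of_posSemidef_smul_sub hX
    (posSemidef_one_kronecker (b := b) (posSemidef_ptraceA hX)) hb
    (posSemidef_card_smul_one_kronecker_ptraceA_sub hX)
  rw [relEnt_one_kronecker_ptraceA hX] at h
  linarith

lemma relEnt_add_relEnt (X Y : Matrix n n ℂ) :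
    relEnt X (X + Y) + relEnt Y (X + Y) = vnEnt (X + Y) - vnEnt X - vnEnt Y := by
  simp only [relEnt, vnEnt, rtr, add_mul, Matrix.trace_add, Complex.add_re]
  ring

lemma vnEnt_add_le {X Y : Matrix n n ℂ} (hX : X.PosSemidef) (hY : Y.PosSemidef) :
    vnEnt (X + Y) ≤ vnEnt X + vnEnt Y := by
  have h1 := relEnt_le_of_posSemidef_smul_sub hX (hX.add hY) one_pos (by simpa using hY)
  have h2 := relEnt_le_of_posSemidef_smul_sub hY (hX.add hY) one_pos (by simpa using hX)
  have h3 := relEnt_add_relEnt X Y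
  simp only [Real.logb_one, mul_zero] at h1 h2
  linarith

lemma le_vnEnt_add {X Y : Matrix n n ℂ} (hX : X.PosSemidef) (hY : Y.PosSemidef)
    (hx : 0 < rtr X) (hy : 0 < rtr Y) :
    vnEnt X + vnEnt Y + rtr X * Real.logb 2 (rtr X) + rtr Y * Real.logb 2 (rtr Y)
      - (rtr X + rtr Y) * Real.logb 2 (rtr X + rtr Y) ≤ vnEnt (X + Y) := by
  have hxy : 0 < rtr X + rtr Y := add_pos hx hy
  have h1 := rtr_mul_logb_le_relEnt hX (hX.add hY)
    (suppLE_of_posSemidef_smul_sub hX (l := 1) (by simpa using hY)) (div_pos hx hxy)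
    (by rw [rtr_add, div_mul_cancel₀ _ hxy.ne'])
  have h2 := rtr_mul_logb_le_relEnt hY (hX.add hY)
    (suppLE_of_posSemidef_smul_sub hY (l := 1) (by simpa using hX)) (div_pos hy hxy)
    (by rw [rtr_add, div_mul_cancel₀ _ hxy.ne'])
  have h3 := relEnt_add_relEnt X Y
  rw [Real.logb_div hx.ne' hxy.ne'] at h1
  rw [Real.logb_div hy.ne' hxy.ne'] at h2
  linarith

lemma condvnEnt_sub_le [Nonempty b] {X Y P Q : Matrix (b × r) (b × r) ℂ} (hX : X.PosSemidef)
    (hY : Y.PosSemidef) (hP : P.PosSemidef) (hQ : Q.PosSemidef) (tY : rtr Y = 1) {ε : ℝ}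
    (hε : 0 < ε) (tP : rtr P = ε) (tQ : rtr Q = ε) (h : X + Q = Y + P) :
    condvnEnt X - condvnEnt Y ≤ 2 * ε * Real.logb 2 (Fintype.card b)
      + (ε + 1) * Real.logb 2 (ε + 1) - ε * Real.logb 2 ε := by
  have h1 := condvnEnt_add_le hX hQ
  have h2 := vnEnt_add_le hY hP
  have h3 := le_vnEnt_add (posSemidef_ptraceA hY) (posSemidef_ptraceA hP)
    (by rw [rtr_ptraceA, tY]; exact one_pos) (by rw [rtr_ptraceA, tP]; exact hε)
  have h4 := condvnEnt_le hP
  have h5 := neg_le_condvnEnt hQ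
  rw [rtr_ptraceA, rtr_ptraceA, tY, tP, ← ptraceA_add, Real.logb_one, add_comm 1 ε] at h3
  rw [h] at h1
  rw [tP] at h4
  rw [tQ] at h5
  simp only [condvnEnt] at *
  linarith

lemma Diagonalizes.traceNorm_eq {U D : Matrix n n ℂ} {d : n → ℝ} (h : Diagonalizes U d D) :
    traceNorm D = ∑ i, |d i| := by
  have h1 : Diagonalizes U (fun i => d i ^ 2) (D.conjTranspose * D) := by
    refine ⟨h.1, ?_⟩
    rw [h.isHermitian.eq]
    conv_lhs => rw [h.2]
    rw [mul_assoc, ← h.2, h.star_mul, ← mul_assoc, mul_assoc U, Matrix.diagonal_mul_diagonal]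
    simp [pow_two]
  rw [traceNorm, mpow, (h1.mfun _).rtr_eq]
  refine Finset.sum_congr rfl fun i _ => ?_
  rw [← Real.sqrt_sq_eq_abs, Real.sqrt_eq_rpow, one_div]

lemma exists_posSemidef_add_eq_add {X Y : Matrix n n ℂ} (hX : IsState X) (hY : IsState Y) {ε : ℝ}
    (h : 2⁻¹ * traceNorm (X - Y) ≤ ε) :
    ∃ P Q : Matrix n n ℂ, P.PosSemidef ∧ Q.PosSemidef ∧ rtr P = ε ∧ rtr Q = ε ∧
      X + Q = Y + P := by
  obtain ⟨U, d, hD⟩ := exists_diagonalizes (hX.1.1.sub hY.1.1)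
  obtain ⟨P, hP⟩ : ∃ P, P = mfun (fun x => max x 0) (X - Y) := ⟨_, rfl⟩
  obtain ⟨Q, hQ⟩ : ∃ Q, Q = mfun (fun x => max (-x) 0) (X - Y) := ⟨_, rfl⟩
  have dP := hP ▸ hD.mfun (fun x => max x 0)
  have dQ := hQ ▸ hD.mfun (fun x => max (-x) 0)
  have pm : ∀ x : ℝ, max x 0 - max (-x) 0 = x := fun x => by
    rcases le_total x 0 with hx | hx
    · rw [max_eq_right hx, max_eq_left (neg_nonneg.2 hx)]; ring
    · rw [max_eq_left hx, max_eq_right (neg_nonpos.2 hx)]; ring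
  have pa : ∀ x : ℝ, max x 0 + max (-x) 0 = |x| := fun x => by
    rcases le_total x 0 with hx | hx
    · rw [max_eq_right hx, max_eq_left (neg_nonneg.2 hx), abs_of_nonpos hx]; ring
    · rw [max_eq_left hx, max_eq_right (neg_nonpos.2 hx), abs_of_nonneg hx]; ring
  have hPQ : P - Q = X - Y := by
    rw [dP.2, dQ.2]
    conv_rhs => rw [hD.2]
    rw [← sub_mul, ← mul_sub, Matrix.diagonal_sub]
    simp only [← Complex.ofReal_sub, pm]
  have t0 : rtr P - rtr Q = 0 := by
    have : rtr (P - Q) = rtr (X - Y) := by rw [hPQ]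
    simpa [rtr, Matrix.trace_sub, hX.2, hY.2] using this
  have t1 : rtr P + rtr Q = traceNorm (X - Y) := by
    rw [dP.rtr_eq, dQ.rtr_eq, hD.traceNorm_eq, ← Finset.sum_add_distrib]
    exact Finset.sum_congr rfl fun i _ => pa _
  have tX : rtr X = 1 := by simp [rtr, hX.2]
  have hle : rtr P ≤ ε := by linarith
  have hS : (((ε - rtr P : ℝ) : ℂ) • X).PosSemidef := by
    refine hX.1.smul ?_
    exact_mod_cast sub_nonneg.2 hle
  have tS : rtr (((ε - rtr P : ℝ) : ℂ) • X) = ε - rtr P := by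
    rw [rtr, Matrix.trace_smul, hX.2]
    simp
  refine ⟨P + ((ε - rtr P : ℝ) : ℂ) • X, Q + ((ε - rtr P : ℝ) : ℂ) • X,
    (dP.posSemidef fun i => le_max_right _ _).add hS,
    (dQ.posSemidef fun i => le_max_right _ _).add hS, ?_, ?_, ?_⟩
  · rw [rtr_add, tS]; ring
  · rw [rtr_add, tS]; linarith
  · rw [sub_eq_sub_iff_add_eq_add, add_comm P] at hPQ
    rw [← add_assoc, ← add_assoc, ← hPQ]

/-- The Alicki-Fannes-Winter continuity bound for the conditional entropy. -/
theorem condvnEnt_continuity [Nonempty b] {X Y : Matrix (b × r) (b × r) ℂ} (hX : IsState X)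
    (hY : IsState Y) {ε : ℝ} (hε : 0 ≤ ε) (h : 2⁻¹ * traceNorm (X - Y) ≤ ε) :
    condvnEnt X - condvnEnt Y ≤ 2 * ε * Real.logb 2 (Fintype.card b)
      + (ε + 1) * Real.logb 2 (ε + 1) - ε * Real.logb 2 ε := by
  obtain ⟨P, Q, hP, hQ, tP, tQ, e⟩ := exists_posSemidef_add_eq_add hX hY h
  rcases hε.eq_or_lt' with h0 | h0
  · have z : ∀ {S : Matrix (b × r) (b × r) ℂ}, S.PosSemidef → rtr S = ε → S = 0 := by
      intro S hS tS
      refine hS.trace_eq_zero_iff.1 (Complex.ext (tS.trans h0) ?_)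
      exact (Complex.nonneg_iff.1 hS.trace_nonneg).2.symm
    rw [z hP tP, z hQ tQ, add_zero, add_zero] at e
    simp [e, h0]
  · exact condvnEnt_sub_le hX.1 hY.1 hP hQ (by simp [rtr, hY.2]) h0 tP tQ e

lemma traceNorm_sub_le {X Y : Matrix n n ℂ} (hX : IsState X) (hY : IsState Y) :
    traceNorm (X - Y) ≤ 2 := by
  obtain ⟨U, d, hD⟩ := exists_diagonalizes (hX.1.1.sub hY.1.1)
  have tr : ∀ {Z : Matrix n n ℂ}, IsState Z →
      ∑ i, (star (U.col i) ⬝ᵥ Z.mulVec (U.col i)).re = 1 := by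
    intro Z hZ
    have h1 : (star U * (Z * U)).trace = 1 := by
      rw [Matrix.trace_mul_comm, mul_assoc, Matrix.mem_unitaryGroup_iff.1 hD.1, mul_one, hZ.2]
    rw [← Complex.re_sum, ← Complex.one_re, ← h1]
    rfl
  rw [hD.traceNorm_eq, show (2 : ℝ) = 1 + 1 by norm_num]
  nth_rewrite 1 [← tr hX]
  rw [← tr hY, ← Finset.sum_add_distrib]
  refine Finset.sum_le_sum fun i _ => ?_
  have e := hD.apply_eq i
  rw [Matrix.sub_mulVec, dotProduct_sub] at e
  have e' := congrArg Complex.re e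
  rw [Complex.ofReal_re, Complex.sub_re] at e'
  have p1 := (Complex.nonneg_iff.1 (hX.1.dotProduct_mulVec_nonneg (U.col i))).1
  have p2 := (Complex.nonneg_iff.1 (hY.1.dotProduct_mulVec_nonneg (U.col i))).1
  rw [e', abs_le]
  constructor <;> linarith

end AlickiFannesWinter

section Channels

variable {a b r : Type*} [Fintype a] [DecidableEq a] [Fintype b] [DecidableEq b]
  [Fintype r] [DecidableEq r]

omit [DecidableEq a] [DecidableEq b] in
lemma ptraceA_tensorId {N : Matrix a a ℂ →ₗ[ℂ] Matrix b b ℂ}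
    (hN : ∀ ρ : Matrix a a ℂ, (N ρ).trace = ρ.trace) (ρ : Matrix (a × r) (a × r) ℂ) :
    ptraceA (tensorId N r ρ) = ptraceA ρ := by
  ext i j
  exact hN (Matrix.of fun x y => ρ (x, i) (y, j))

lemma tensorId_randomizing (ρ : Matrix (a × r) (a × r) ℂ) :
    tensorId (randomizing a b) r ρ
      = ((((Fintype.card b : ℝ)⁻¹ : ℝ) : ℂ)) • ((1 : Matrix b b ℂ) ⊗ₖ ptraceA ρ) := by
  ext ⟨i, k⟩ ⟨j, l⟩
  simp [tensorId, randomizing, maxMixed, ptraceA, Matrix.trace]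
  ring

omit [DecidableEq a] [DecidableEq b] in
lemma IsChannel.isState {N : Matrix a a ℂ →ₗ[ℂ] Matrix b b ℂ} (hN : IsChannel N) {k : ℕ}
    {ρ : Matrix (a × Fin k) (a × Fin k) ℂ} (hρ : IsState ρ) :
    IsState (tensorId N (Fin k) ρ) :=
  ⟨hN.2 k ρ hρ.1, by rw [← trace_ptraceA, ptraceA_tensorId hN.1, trace_ptraceA, hρ.2]⟩

lemma relEnt_randomizing_sub {N M : Matrix a a ℂ →ₗ[ℂ] Matrix b b ℂ} (hN : IsChannel N)
    (hM : IsChannel M) {ρ : Matrix (a × r) (a × r) ℂ} (hρ : IsState ρ) :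
    relEnt (tensorId N r ρ) (tensorId (randomizing a b) r ρ)
      - relEnt (tensorId M r ρ) (tensorId (randomizing a b) r ρ)
      = condvnEnt (tensorId M r ρ) - condvnEnt (tensorId N r ρ) := by
  have h := mfun_smul_one_kronecker (b := b) (posSemidef_ptraceA hρ.1).1
    ((Fintype.card b : ℝ)⁻¹) (Real.logb 2)
  rw [tensorId_randomizing]
  simp only [relEnt, condvnEnt, vnEnt, mlog]
  rw [h, rtr_mul_one_kronecker, rtr_mul_one_kronecker, ptraceA_tensorId hN.1,
    ptraceA_tensorId hM.1]
  ring

omit [DecidableEq a] in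
lemma traceNorm_le_diamondDist {N M : Matrix a a ℂ →ₗ[ℂ] Matrix b b ℂ} (hN : IsChannel N)
    (hM : IsChannel M) {k : ℕ} {ρ : Matrix (a × Fin k) (a × Fin k) ℂ} (hρ : IsState ρ) :
    traceNorm (tensorId N (Fin k) ρ - tensorId M (Fin k) ρ) ≤ diamondDist N M := by
  refine le_ciSup (f := fun p : Σ k : ℕ, {ρ : Matrix (a × Fin k) (a × Fin k) ℂ // IsState ρ} =>
    traceNorm (tensorId N (Fin p.1) p.2.1 - tensorId M (Fin p.1) p.2.1)) ?_ ⟨k, ρ, hρ⟩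
  refine ⟨2, ?_⟩
  rintro _ ⟨p, rfl⟩
  exact traceNorm_sub_le (hN.isState p.2.2) (hM.isState p.2.2)

lemma abs_iSup_sub_iSup_le {ι : Sort*} {f g : ι → ℝ} {δ : ℝ} (hδ : 0 ≤ δ)
    (h : ∀ i, |f i - g i| ≤ δ) : |(⨆ i, f i) - ⨆ i, g i| ≤ δ := by
  have bdd : ∀ {f g : ι → ℝ}, (∀ i, |f i - g i| ≤ δ) → BddAbove (Set.range g) →
      BddAbove (Set.range f) := by
    rintro f g h ⟨c, hc⟩
    refine ⟨c + δ, ?_⟩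
    rintro _ ⟨i, rfl⟩
    have := hc ⟨i, rfl⟩
    linarith [(abs_le.1 (h i)).2]
  have le : ∀ {f g : ι → ℝ}, (∀ i, |f i - g i| ≤ δ) → BddAbove (Set.range g) →
      (⨆ i, f i) - ⨆ i, g i ≤ δ := by
    intro f g h hg
    rcases isEmpty_or_nonempty ι with hι | hι
    · simpa [Real.iSup_of_isEmpty] using hδ
    rw [sub_le_iff_le_add]
    refine ciSup_le fun i => ?_
    linarith [(abs_le.1 (h i)).2, le_ciSup hg i]
  have h' : ∀ i, |g i - f i| ≤ δ := fun i => by rw [abs_sub_comm]; exact h i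
  by_cases hg : BddAbove (Set.range g)
  · rw [abs_sub_le_iff]
    exact ⟨le h hg, le h' (bdd h hg)⟩
  · have hf : ¬ BddAbove (Set.range f) := fun hf => hg (bdd h' hf)
    rw [Real.iSup_of_not_bddAbove hf, Real.iSup_of_not_bddAbove hg]
    simpa using hδ

end Channels

theorem channel_entropy_continuity {A B : Type} [Fintype A] [DecidableEq A] [Nonempty A]
    [Fintype B] [DecidableEq B] [Nonempty B]
    (N M : Matrix A A ℂ →ₗ[ℂ] Matrix B B ℂ) (hN : IsChannel N) (hM : IsChannel M)
    (ε : ℝ) (hε : ε ∈ Set.Icc (0 : ℝ) 1) (hdist : 2⁻¹ * diamondDist N M ≤ ε) :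
    |chEnt N - chEnt M| ≤ 2 * ε * Real.logb 2 (Fintype.card B)
      + (ε + 1) * Real.logb 2 (ε + 1) - ε * Real.logb 2 ε := by
  have hlog : (0 : ℝ) ≤ Real.logb 2 (Fintype.card B) :=
    Real.logb_nonneg one_lt_two (by exact_mod_cast Fintype.card_pos)
  have h1 : 0 ≤ Real.logb 2 (ε + 1) := Real.logb_nonneg one_lt_two (by linarith [hε.1])
  have h2 : Real.logb 2 ε ≤ 0 := Real.logb_nonpos one_lt_two hε.1 hε.2
  have h3 : ε * Real.logb 2 ε ≤ 0 := mul_nonpos_of_nonneg_of_nonpos hε.1 h2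
  have h4 : 0 ≤ (ε + 1) * Real.logb 2 (ε + 1) := mul_nonneg (by linarith [hε.1]) h1
  have h5 : 0 ≤ 2 * ε * Real.logb 2 (Fintype.card B) :=
    mul_nonneg (mul_nonneg zero_le_two hε.1) hlog
  rw [chEnt, chEnt, sub_sub_sub_cancel_left, chRelEnt, chRelEnt, abs_sub_comm]
  refine abs_iSup_sub_iSup_le (by linarith) fun p => ?_
  have hd := traceNorm_le_diamondDist hN hM p.2.2
  have hd' := traceNorm_le_diamondDist hM hN p.2.2
  have sN := hN.isState p.2.2
  have sM := hM.isState p.2.2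
  have t : traceNorm (tensorId M (Fin p.1) p.2.1 - tensorId N (Fin p.1) p.2.1)
      = traceNorm (tensorId N (Fin p.1) p.2.1 - tensorId M (Fin p.1) p.2.1) := by
    rw [traceNorm, traceNorm, ← neg_sub, Matrix.conjTranspose_neg, neg_mul_neg]
  rw [relEnt_randomizing_sub hN hM p.2.2, abs_le]
  have c1 := condvnEnt_continuity sN sM hε.1 (by linarith)
  have c2 := condvnEnt_continuity sM sN hε.1 (by linarith)
  constructor <;> linarith

end QIT
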